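/- arXiv:2302.05168 — 5 statements merged into one kernel-verified Lean document; each statement's English description precedes it below -/
import Mathlib

section
/- Let V, W, Z be complex Hilbert spaces and let R : Z ⊇ dom R → V × W be a linear operator, with P_V and P_W the canonical projections of V × W onto V and W. Then the following are equivalent: (i) R is closed (its graph is closed in Z × (V × W)) and the operator P_V R : Z ⊇ dom R → V is closed; (ii) P_V R : Z ⊇ dom R → V is closed and P_W R is bounded with respect to the graph norm of P_V R, i.e. there exists C > 0 such that ‖P_W R z‖_W ≤ C (‖z‖_Z + ‖P_V R z‖_V) for all z ∈ dom R; (iii) R is closed and there exists C > 0 such that ‖P_W R z‖_W ≤ C (‖z‖_Z + ‖P_V R z‖_V) for all z ∈ dom R. -/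
theorem block_graph_closed
    {V W Z : Type*}
    [NormedAddCommGroup V] [InnerProductSpace ℂ V] [CompleteSpace V]
    [NormedAddCommGroup W] [InnerProductSpace ℂ W] [CompleteSpace W]
    [NormedAddCommGroup Z] [InnerProductSpace ℂ Z] [CompleteSpace Z]
    (R : Z →ₗ.[ℂ] V × W)
    (h1 : IsClosed {q : Z × V | ∃ z : R.domain, (z : Z) = q.1 ∧ (R z).1 = q.2})
    (h2 : ∃ C : ℝ, 0 < C ∧ ∀ z : R.domain, ‖(R z).2‖ ≤ C * (‖(z : Z)‖ + ‖(R z).1‖)) :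
    IsClosed (R.graph : Set (Z × (V × W))) := by
  obtain ⟨C, hC, hb⟩ := h2
  have key : ∀ z0 : R.domain, ∀ x ∈ closure (R.graph : Set (Z × (V × W))),
      ‖x.2.2 - (R z0).2‖ ≤ C * (‖x.1 - z0‖ + ‖x.2.1 - (R z0).1‖) := by
    intro z0
    have hcl : IsClosed {x : Z × (V × W) |
        ‖x.2.2 - (R z0).2‖ ≤ C * (‖x.1 - z0‖ + ‖x.2.1 - (R z0).1‖)} :=
      isClosed_le (by fun_prop) (by fun_prop)
    refine closure_minimal ?_ hcl
    intro x hx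
    obtain ⟨y, hy1, hy2⟩ := (LinearPMap.mem_graph_iff R).1 hx
    have := hb (y - z0)
    rw [LinearPMap.map_sub] at this
    change ‖x.2.2 - (R z0).2‖ ≤ C * (‖x.1 - z0‖ + ‖x.2.1 - (R z0).1‖)
    simpa [← hy1, ← hy2] using this
  have key2 : closure (R.graph : Set (Z × (V × W))) ⊆
      (fun x : Z × (V × W) => (x.1, x.2.1)) ⁻¹'
        {q : Z × V | ∃ z : R.domain, (z : Z) = q.1 ∧ (R z).1 = q.2} := by
    refine closure_minimal ?_ (h1.preimage (by fun_prop))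
    intro x hx
    obtain ⟨y, hy1, hy2⟩ := (LinearPMap.mem_graph_iff R).1 hx
    exact ⟨y, hy1, by rw [hy2]⟩
  refine isClosed_of_closure_subset fun x hx => ?_
  obtain ⟨z, hz1, hz2⟩ := key2 hx
  have h := key z x hx
  dsimp only at hz1 hz2
  rw [hz1, hz2] at h
  simp only [sub_self, norm_zero, add_zero, mul_zero] at h
  have h' := sub_eq_zero.1 (norm_le_zero_iff.1 h)
  exact (LinearPMap.mem_graph_iff R).2 ⟨z, hz1, Prod.ext hz2 h'.symm⟩

theorem block_fst_closed
    {V W Z : Type*}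
    [NormedAddCommGroup V] [InnerProductSpace ℂ V] [CompleteSpace V]
    [NormedAddCommGroup W] [InnerProductSpace ℂ W] [CompleteSpace W]
    [NormedAddCommGroup Z] [InnerProductSpace ℂ Z] [CompleteSpace Z]
    (R : Z →ₗ.[ℂ] V × W)
    (h1 : IsClosed (R.graph : Set (Z × (V × W))))
    (h2 : ∃ C : ℝ, 0 < C ∧ ∀ z : R.domain, ‖(R z).2‖ ≤ C * (‖(z : Z)‖ + ‖(R z).1‖)) :
    IsClosed {q : Z × V | ∃ z : R.domain, (z : Z) = q.1 ∧ (R z).1 = q.2} := by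
  obtain ⟨C, hC, hb⟩ := h2
  have : CompleteSpace R.graph := h1.completeSpace_coe
  let f : R.graph →L[ℂ] Z × V :=
    ((ContinuousLinearMap.fst ℂ Z (V × W)).prod
      ((ContinuousLinearMap.fst ℂ V W).comp (ContinuousLinearMap.snd ℂ Z (V × W)))).comp
      R.graph.subtypeL
  have hf : ∀ x : R.graph, f x = (x.1.1, x.1.2.1) := fun _ => rfl
  have hanti : AntilipschitzWith (Real.toNNReal (1 + 2 * C)) f := by
    refine AddMonoidHomClass.antilipschitz_of_bound f fun x => ?_
    obtain ⟨⟨z, v, w⟩, hx⟩ := x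
    obtain ⟨y, hy1, hy2⟩ := (LinearPMap.mem_graph_iff R).1 hx
    have hw := hb y
    simp only at hy1 hy2
    rw [hy1, hy2] at hw
    rw [hf, Real.coe_toNNReal _ (by positivity)]
    simp only [Submodule.coe_norm] at *
    have a1 : ‖z‖ ≤ ‖(z, v)‖ := norm_fst_le (z, v)
    have a2 : ‖v‖ ≤ ‖(z, v)‖ := norm_snd_le (z, v)
    have a3 : 0 ≤ C * ‖(z, v)‖ := by positivity
    have a4 : C * (‖z‖ + ‖v‖) ≤ C * (‖(z, v)‖ + ‖(z, v)‖) := by gcongr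
    refine norm_prod_le_iff.2 ⟨?_, norm_prod_le_iff.2 ⟨?_, ?_⟩⟩ <;> dsimp only <;> nlinarith
  have hr : IsClosed (Set.range f) := hanti.isClosed_range f.uniformContinuous
  suffices hs : {q : Z × V | ∃ z : R.domain, (z : Z) = q.1 ∧ (R z).1 = q.2} = Set.range f by
    rw [hs]
    exact hr
  ext q
  constructor
  · rintro ⟨z, h1, h2⟩
    exact ⟨⟨(z, R z), R.mem_graph z⟩, by rw [hf]; exact Prod.ext h1 h2⟩
  · rintro ⟨⟨x, hx⟩, rfl⟩
    obtain ⟨y, hy1, hy2⟩ := (LinearPMap.mem_graph_iff R).1 hx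
    exact ⟨y, by rw [hf]; exact hy1, by rw [hf, hy2]⟩

theorem block_bound
    {V W Z : Type*}
    [NormedAddCommGroup V] [InnerProductSpace ℂ V] [CompleteSpace V]
    [NormedAddCommGroup W] [InnerProductSpace ℂ W] [CompleteSpace W]
    [NormedAddCommGroup Z] [InnerProductSpace ℂ Z] [CompleteSpace Z]
    (R : Z →ₗ.[ℂ] V × W)
    (h1 : IsClosed (R.graph : Set (Z × (V × W))))
    (h2 : IsClosed {q : Z × V | ∃ z : R.domain, (z : Z) = q.1 ∧ (R z).1 = q.2}) :
    ∃ C : ℝ, 0 < C ∧ ∀ z : R.domain, ‖(R z).2‖ ≤ C * (‖(z : Z)‖ + ‖(R z).1‖) := by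
  let A : R.domain →ₗ[ℂ] Z × V :=
    R.domain.subtype.prod ((LinearMap.fst ℂ V W).comp R.toFun)
  have hA : ∀ z, A z = ((z : Z), (R z).1) := fun _ => rfl
  have hinj : Function.Injective A := fun x y h => Subtype.ext (congrArg Prod.fst h)
  have hcl : IsClosed (LinearMap.range A : Set (Z × V)) := by
    convert h2 using 1
    ext q
    simp [hA, Prod.ext_iff]
  have : CompleteSpace (LinearMap.range A) := hcl.completeSpace_coe
  let e := LinearEquiv.ofInjective A hinj
  let g : LinearMap.range A →ₗ[ℂ] W :=
    ((LinearMap.snd ℂ V W).comp R.toFun).comp e.symm.toLinearMap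
  have hg : ∀ z, g (e z) = (R z).2 := fun z => by
    change (R (e.symm (e z))).2 = _
    rw [e.symm_apply_apply]
  have he : ∀ z, (e z : Z × V) = ((z : Z), (R z).1) := fun _ => rfl
  have hgc : IsClosed (g.graph : Set (LinearMap.range A × W)) := by
    have : (g.graph : Set (LinearMap.range A × W)) =
        (fun x : LinearMap.range A × W => ((x.1 : Z × V).1, ((x.1 : Z × V).2, x.2))) ⁻¹'
          (R.graph : Set (Z × (V × W))) := by
      ext ⟨q, w⟩
      obtain ⟨z, rfl⟩ := e.surjective q
      simp only [SetLike.mem_coe, LinearMap.mem_graph_iff, Set.mem_preimage,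
        LinearPMap.mem_graph_iff, hg, he]
      constructor
      · rintro rfl
        exact ⟨z, rfl, rfl⟩
      · rintro ⟨y, hy, hy2⟩
        obtain rfl : y = z := Subtype.ext hy
        rw [hy2]
    rw [this]
    exact h1.preimage (by fun_prop)
  let G := ContinuousLinearMap.ofIsClosedGraph hgc
  obtain ⟨C, hC, hb⟩ := G.bound
  refine ⟨C, hC, fun z => ?_⟩
  have h : ‖g (e z)‖ ≤ C * ‖e z‖ := hb (e z)
  rw [hg, Submodule.coe_norm, he] at h
  refine h.trans ?_
  gcongr
  refine norm_prod_le_iff.2 ⟨?_, ?_⟩ <;> simp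

/-- Closedness of block operators (Lemma `lem:closedblock`).
`R : Z ⊇ dom R → V × W` is an unbounded linear operator, encoded as a `LinearPMap`.
`P_V R` is the operator with the same domain mapping `z` to the first component of `R z`;
its graph is the set below. -/
theorem closedness_of_block_operators
    {V W Z : Type*}
    [NormedAddCommGroup V] [InnerProductSpace ℂ V] [CompleteSpace V]
    [NormedAddCommGroup W] [InnerProductSpace ℂ W] [CompleteSpace W]
    [NormedAddCommGroup Z] [InnerProductSpace ℂ Z] [CompleteSpace Z]
    (R : Z →ₗ.[ℂ] V × W)
    -- graph of `P_V R`
    (pVGraph : Set (Z × V))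
    (hpVGraph : pVGraph = {q : Z × V | ∃ z : R.domain, (z : Z) = q.1 ∧ (R z).1 = q.2}) :
    -- (i) ↔ (ii) and (ii) ↔ (iii)
    ((IsClosed (R.graph : Set (Z × (V × W))) ∧ IsClosed pVGraph) ↔
      (IsClosed pVGraph ∧
        ∃ C : ℝ, 0 < C ∧ ∀ z : R.domain, ‖(R z).2‖ ≤ C * (‖(z : Z)‖ + ‖(R z).1‖))) ∧
    ((IsClosed pVGraph ∧
        ∃ C : ℝ, 0 < C ∧ ∀ z : R.domain, ‖(R z).2‖ ≤ C * (‖(z : Z)‖ + ‖(R z).1‖)) ↔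
      (IsClosed (R.graph : Set (Z × (V × W))) ∧
        ∃ C : ℝ, 0 < C ∧ ∀ z : R.domain, ‖(R z).2‖ ≤ C * (‖(z : Z)‖ + ‖(R z).1‖))) := by
  subst hpVGraph
  have hB := block_graph_closed R
  have hA := block_bound R
  have hC := block_fst_closed R
  refine ⟨⟨fun h => ⟨h.2, hA h.1 h.2⟩, fun h => ⟨hB h.1 h.2, h.1⟩⟩,
    ⟨fun h => ⟨hB h.1 h.2, h.2⟩, fun h => ⟨hC h.1 h.2, h.2⟩⟩⟩
end

section
/- Let m ∈ ℕ, let P₁ ∈ ℂ^{m×m} be Hermitian, and let W_B, W_C ∈ ℂ^{m×2m} satisfy Σ = V Σ V*, where Σ := [[0, I_m],[I_m, 0]] ∈ ℂ^{2m×2m} and V := [[W_B],[W_C]] is the 2m×2m matrix with block rows W_B and W_C. Then V is invertible, and for all vectors z_a, z_b ∈ ℂ^m, setting u := (1/√2)·W_B·[[P₁, −P₁],[I_m, I_m]]·(z_b, z_a) and y := (1/√2)·W_C·[[P₁, −P₁],[I_m, I_m]]·(z_b, z_a), where (z_b, z_a) ∈ ℂ^{2m} denotes the column vector with upper block z_b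 and lower block z_a, one has ½·Re(z_b* P₁ z_b − z_a* P₁ z_a) = Re(u* y). (Here w* denotes the conjugate transpose, so w* A v is the inner product of A v against w; since P₁ is Hermitian, z* P₁ z is real.) -/
open Matrix

lemma re_star_dot_comm {n : ℕ} (b c : Fin n → ℂ) :
    (star c ⬝ᵥ b).re = (star b ⬝ᵥ c).re := by
  have h : star c ⬝ᵥ b = star (star b ⬝ᵥ c) := by
    rw [Matrix.star_dotProduct]
  rw [h]; simp

lemma swap_form {n : ℕ} (b c : Fin n → ℂ) :
    (star (Sum.elim b c) ⬝ᵥ ((Matrix.fromBlocks 0 1 1 0 :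
      Matrix (Fin n ⊕ Fin n) (Fin n ⊕ Fin n) ℂ) *ᵥ Sum.elim b c)).re
      = 2 * (star b ⬝ᵥ c).re := by
  have h : star (Sum.elim b c) ⬝ᵥ ((Matrix.fromBlocks 0 1 1 0 :
      Matrix (Fin n ⊕ Fin n) (Fin n ⊕ Fin n) ℂ) *ᵥ Sum.elim b c)
      = star b ⬝ᵥ c + star c ⬝ᵥ b := by
    rw [Matrix.fromBlocks_mulVec]
    simp [dotProduct, Fintype.sum_sum_type]
  rw [h, Complex.add_re, re_star_dot_comm b c]; ring

/-- Let `P₁ ∈ ℂ^{m×m}` be Hermitian and let `W_B, W_C ∈ ℂ^{m×2m}` satisfy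
`Σ = V Σ Vᴴ` with `Σ = [[0, I],[I, 0]]` and `V` the matrix with block rows `W_B, W_C`.
Then `V` is invertible and, for `u` and `y` defined from the boundary values
`(z_b, z_a)` via `u = (1/√2)·W_B·[[P₁, −P₁],[I, I]]·(z_b, z_a)` and
`y = (1/√2)·W_C·[[P₁, −P₁],[I, I]]·(z_b, z_a)`, one has
`½·Re(z_b* P₁ z_b − z_a* P₁ z_a) = Re(u* y)`. -/
theorem boundary_port_identity
    (m : ℕ) (P₁ : Matrix (Fin m) (Fin m) ℂ) (hP₁ : P₁.IsHermitian)
    (W_B W_C : Matrix (Fin m) (Fin m ⊕ Fin m) ℂ)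
    (V : Matrix (Fin m ⊕ Fin m) (Fin m ⊕ Fin m) ℂ)
    (hV : V = Matrix.fromRows W_B W_C)
    (Sig : Matrix (Fin m ⊕ Fin m) (Fin m ⊕ Fin m) ℂ)
    (hSig : Sig = Matrix.fromBlocks 0 1 1 0)
    (hWBC : Sig = V * Sig * Vᴴ)
    (z_a z_b : Fin m → ℂ)
    (u y : Fin m → ℂ)
    (hu : u = ((Real.sqrt 2 : ℂ))⁻¹ •
      (W_B *ᵥ (Matrix.fromBlocks P₁ (-P₁) 1 1 *ᵥ Sum.elim z_b z_a)))
    (hy : y = ((Real.sqrt 2 : ℂ))⁻¹ •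
      (W_C *ᵥ (Matrix.fromBlocks P₁ (-P₁) 1 1 *ᵥ Sum.elim z_b z_a))) :
    IsUnit V ∧
    (1 / 2) * ((star z_b ⬝ᵥ (P₁ *ᵥ z_b)) - (star z_a ⬝ᵥ (P₁ *ᵥ z_a))).re =
      (star u ⬝ᵥ y).re := by
  have hSS : Sig * Sig = 1 := by
    rw [hSig, Matrix.fromBlocks_multiply]; simp
  have h1 : V * (Sig * Vᴴ * Sig) = 1 := by
    calc V * (Sig * Vᴴ * Sig) = (V * Sig * Vᴴ) * Sig := by simp only [Matrix.mul_assoc]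
      _ = 1 := by rw [← hWBC, hSS]
  have h2 : (Sig * Vᴴ * Sig) * V = 1 := mul_eq_one_comm.mp h1
  have h3 : Vᴴ * (Sig * V) = Sig := by
    calc Vᴴ * (Sig * V) = (Sig * Sig) * (Vᴴ * (Sig * V)) := by rw [hSS, Matrix.one_mul]
      _ = Sig * ((Sig * Vᴴ * Sig) * V) := by simp only [Matrix.mul_assoc]
      _ = Sig := by rw [h2, Matrix.mul_one]
  refine ⟨⟨⟨V, _, h1, h2⟩, rfl⟩, ?_⟩
  have hw : Matrix.fromBlocks P₁ (-P₁) 1 1 *ᵥ Sum.elim z_b z_a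
      = Sum.elim (P₁ *ᵥ z_b - P₁ *ᵥ z_a) (z_b + z_a) := by
    rw [Matrix.fromBlocks_mulVec]
    simp [Matrix.neg_mulVec, sub_eq_add_neg]
  rw [hw] at hu hy
  set e := P₁ *ᵥ z_b - P₁ *ᵥ z_a with he
  set f := z_b + z_a with hf
  have hVw : V *ᵥ Sum.elim e f = Sum.elim (W_B *ᵥ Sum.elim e f) (W_C *ᵥ Sum.elim e f) := by
    rw [hV, Matrix.fromRows_mulVec]
  have key : star (V *ᵥ Sum.elim e f) ⬝ᵥ (Sig *ᵥ (V *ᵥ Sum.elim e f))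
      = star (Sum.elim e f) ⬝ᵥ (Sig *ᵥ Sum.elim e f) := by
    rw [Matrix.star_mulVec, ← Matrix.dotProduct_mulVec, Matrix.mulVec_mulVec,
      Matrix.mulVec_mulVec, Matrix.mul_assoc, h3]
  have key2 := congrArg Complex.re key
  rw [hVw, hSig, swap_form, swap_form] at key2
  have huy : (star u ⬝ᵥ y).re
      = (1 / 2) * (star (W_B *ᵥ Sum.elim e f) ⬝ᵥ (W_C *ᵥ Sum.elim e f)).re := by
    have hs : star ((Real.sqrt 2 : ℂ))⁻¹ * ((Real.sqrt 2 : ℂ))⁻¹ = ((1 / 2 : ℝ) : ℂ) := by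
      have : star ((Real.sqrt 2 : ℂ))⁻¹ = ((Real.sqrt 2 : ℂ))⁻¹ := by
        simp
      rw [this, ← mul_inv, ← Complex.ofReal_mul, Real.mul_self_sqrt (by norm_num)]
      norm_num
    rw [hu, hy, star_smul, smul_dotProduct, dotProduct_smul, smul_smul, hs, smul_eq_mul,
      Complex.re_ofReal_mul]
  have hadj : ∀ x v : Fin m → ℂ, star (P₁ *ᵥ x) ⬝ᵥ v = star x ⬝ᵥ (P₁ *ᵥ v) := by
    intro x v
    rw [Matrix.star_mulVec, hP₁.eq, ← Matrix.dotProduct_mulVec]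
  have hcross : (star z_a ⬝ᵥ (P₁ *ᵥ z_b)).re = (star z_b ⬝ᵥ (P₁ *ᵥ z_a)).re := by
    rw [← hadj, re_star_dot_comm]
  have hef : (star e ⬝ᵥ f).re
      = ((star z_b ⬝ᵥ (P₁ *ᵥ z_b)) - (star z_a ⬝ᵥ (P₁ *ᵥ z_a))).re := by
    rw [he, hf, star_sub, sub_dotProduct, dotProduct_add, dotProduct_add, hadj, hadj, hadj, hadj]
    simp only [Complex.sub_re, Complex.add_re]
    linarith
  rw [huy, ← hef]
  linarith
end

section
/- Let m ∈ ℕ, let a < b be real numbers, let P₀ : [a, b] → ℂ^{m×m} be measurable and bounded with, for almost every ξ ∈ [a, b], Re(w* P₀(ξ) w) ≤ 0 for all w ∈ ℂ^m, and let P₁ ∈ ℂ^{m×m} be Hermitian. Let W_B, W_C ∈ ℂ^{m×2m} satisfy Σ = V Σ V* with Σ := [[0, I_m],[I_m, 0]] and V := [[W_B],[W_C]]. Let z : ℝ → ℂ^m be continuously differentiable on [a, b] and set u := (1/√2)·W_B·[[P₁, −P₁],[I_m, I_m]]·(z(b), z(a)) and y := (1/√2)·W_C·[[P₁, −P₁],[I_m,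 I_m]]·(z(b), z(a)). Then ∫_a^b Re( z(ξ)* ( P₀(ξ) z(ξ) + P₁ z'(ξ) ) ) dξ ≤ Re(u* y), i.e. the operator z ↦ P₀ z + P₁ ∂_ξ z with the port variables (u, y) is dissipative. -/
open Matrix MeasureTheory

lemma aux_herm_re {n : Type*} [Fintype n] (P : Matrix n n ℂ) (hP : P.IsHermitian)
    (v w : n → ℂ) : (star v ⬝ᵥ (P *ᵥ w)).re = (star w ⬝ᵥ (P *ᵥ v)).re := by
  have h : star (star v ⬝ᵥ (P *ᵥ w)) = star w ⬝ᵥ (P *ᵥ v) := by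
    rw [← Matrix.star_dotProduct, star_mulVec, hP.eq, ← dotProduct_mulVec]
  rw [← h]
  simp

lemma aux_deriv {m : ℕ} (P : Matrix (Fin m) (Fin m) ℂ) (hP : P.IsHermitian)
    (z : ℝ → (Fin m → ℂ)) (d : Fin m → ℂ) (x : ℝ) (hz : HasDerivAt z d x) :
    HasDerivAt (fun t => (1 / 2 : ℝ) * (star (z t) ⬝ᵥ (P *ᵥ z t)).re)
      ((star (z x) ⬝ᵥ (P *ᵥ d)).re) x := by
  have hzi := hasDerivAt_pi.1 hz
  have h1 : HasDerivAt (fun t => star (z t) ⬝ᵥ (P *ᵥ z t))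
      (star d ⬝ᵥ (P *ᵥ z x) + star (z x) ⬝ᵥ (P *ᵥ d)) x := by
    simp only [dotProduct, mulVec, Pi.star_apply, ← Finset.sum_add_distrib]
    refine HasDerivAt.fun_sum fun i _ => ?_
    refine HasDerivAt.mul (hzi i).star ?_
    exact HasDerivAt.fun_sum fun j _ => (hzi j).const_mul _
  have h2 : HasDerivAt (fun t => (star (z t) ⬝ᵥ (P *ᵥ z t)).re)
      ((star d ⬝ᵥ (P *ᵥ z x) + star (z x) ⬝ᵥ (P *ᵥ d)).re) x :=
    (Complex.reCLM.hasFDerivAt.comp_hasDerivAt x h1)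
  have h3 := h2.const_mul (1 / 2 : ℝ)
  have e : (1 / 2 : ℝ) * (star d ⬝ᵥ (P *ᵥ z x) + star (z x) ⬝ᵥ (P *ᵥ d)).re
      = (star (z x) ⬝ᵥ (P *ᵥ d)).re := by
    rw [Complex.add_re, aux_herm_re P hP d]
    ring
  rw [e] at h3
  exact h3

lemma aux_sig {m : ℕ} (p q : Fin m → ℂ) :
    (star (Sum.elim p q) ⬝ᵥ ((Matrix.fromBlocks 0 1 1 0 : Matrix (Fin m ⊕ Fin m) (Fin m ⊕ Fin m) ℂ)
      *ᵥ Sum.elim p q)).re = 2 * (star p ⬝ᵥ q).re := by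
  have h : (star q ⬝ᵥ p).re = (star p ⬝ᵥ q).re := by
    simpa using aux_herm_re (1 : Matrix (Fin m) (Fin m) ℂ) Matrix.isHermitian_one q p
  have h0 : star (Sum.elim p q) = Sum.elim (star p) (star q) := by
    ext i; cases i <;> rfl
  rw [fromBlocks_mulVec, h0, sumElim_dotProduct_sumElim]
  simp only [Function.comp_def, Sum.elim_inl, Sum.elim_inr]
  simp [h]
  ring

lemma aux_port {m : ℕ} (P₁ : Matrix (Fin m) (Fin m) ℂ) (hP₁ : P₁.IsHermitian)
    (W_B W_C : Matrix (Fin m) (Fin m ⊕ Fin m) ℂ)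
    (V : Matrix (Fin m ⊕ Fin m) (Fin m ⊕ Fin m) ℂ)
    (hV : V = Matrix.fromRows W_B W_C)
    (Sig : Matrix (Fin m ⊕ Fin m) (Fin m ⊕ Fin m) ℂ)
    (hSig : Sig = Matrix.fromBlocks 0 1 1 0)
    (hWBC : Sig = V * Sig * Vᴴ) (p q : Fin m → ℂ)
    (u y : Fin m → ℂ)
    (hu : u = ((Real.sqrt 2 : ℂ))⁻¹ •
      (W_B *ᵥ (Matrix.fromBlocks P₁ (-P₁) 1 1 *ᵥ Sum.elim p q)))
    (hy : y = ((Real.sqrt 2 : ℂ))⁻¹ •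
      (W_C *ᵥ (Matrix.fromBlocks P₁ (-P₁) 1 1 *ᵥ Sum.elim p q))) :
    (star u ⬝ᵥ y).re = (1 / 2 : ℝ) * (star p ⬝ᵥ (P₁ *ᵥ p)).re
      - (1 / 2 : ℝ) * (star q ⬝ᵥ (P₁ *ᵥ q)).re := by
  have hSS : Sig * Sig = 1 := by
    rw [hSig, fromBlocks_multiply]; simp
  have hinv : V * (Sig * Vᴴ * Sig) = 1 := by
    rw [← mul_assoc, ← mul_assoc, ← hWBC, hSS]
  have hinv2 : Sig * Vᴴ * Sig * V = 1 := mul_eq_one_comm.1 hinv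
  have hVSV : Vᴴ * Sig * V = Sig := by
    calc Vᴴ * Sig * V = (Sig * Sig) * (Vᴴ * Sig * V) := by rw [hSS, one_mul]
      _ = Sig * (Sig * Vᴴ * Sig * V) := by simp only [mul_assoc]
      _ = Sig := by rw [hinv2, mul_one]
  set f : Fin m ⊕ Fin m → ℂ := Matrix.fromBlocks P₁ (-P₁) 1 1 *ᵥ Sum.elim p q with hf
  have hf' : f = Sum.elim (P₁ *ᵥ p - P₁ *ᵥ q) (p + q) := by
    rw [hf, fromBlocks_mulVec]
    simp [Function.comp_def, neg_mulVec, sub_eq_add_neg]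
  have key : star (V *ᵥ f) ⬝ᵥ (Sig *ᵥ (V *ᵥ f)) = star f ⬝ᵥ (Sig *ᵥ f) := by
    rw [star_mulVec, ← dotProduct_mulVec, mulVec_mulVec, mulVec_mulVec, hVSV]
  have hVf : V *ᵥ f = Sum.elim (W_B *ᵥ f) (W_C *ᵥ f) := by
    rw [hV, fromRows_mulVec]
  have k2 := congrArg Complex.re key
  rw [hVf, hf', hSig, aux_sig, aux_sig, ← hf'] at k2
  have hs : star u ⬝ᵥ y = ((1 / 2 : ℝ) : ℂ) * (star (W_B *ᵥ f) ⬝ᵥ (W_C *ᵥ f)) := by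
    have h2 : ((Real.sqrt 2 : ℂ))⁻¹ * ((Real.sqrt 2 : ℂ))⁻¹ = ((1 / 2 : ℝ) : ℂ) := by
      rw [← mul_inv, ← Complex.ofReal_mul, Real.mul_self_sqrt (by norm_num)]
      norm_num
    rw [hu, hy, star_smul, smul_dotProduct, dotProduct_smul, smul_smul, ← h2, smul_eq_mul]
    congr 2
    simp
  rw [hs, Complex.re_ofReal_mul]
  have e : (star (P₁ *ᵥ p - P₁ *ᵥ q) ⬝ᵥ (p + q)).re
      = (star p ⬝ᵥ (P₁ *ᵥ p)).re - (star q ⬝ᵥ (P₁ *ᵥ q)).re := by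
    rw [← mulVec_sub, star_mulVec, hP₁.eq, ← dotProduct_mulVec, mulVec_add, star_sub,
      sub_dotProduct, dotProduct_add, dotProduct_add]
    simp only [Complex.sub_re, Complex.add_re]
    rw [aux_herm_re P₁ hP₁ q p]
    ring
  rw [e] at k2
  linarith

/-- dissipativity of the hyperbolic operator with boundary ports:
With `P₀` measurable, bounded and pointwise dissipative a.e. on `[a, b]`, `P₁` Hermitian,
`W_B, W_C` satisfying `Σ = V Σ Vᴴ`, and `z` continuously differentiable on `[a, b]`,
the boundary port variables `u, y` satisfy
`∫_a^b Re(z* (P₀ z + P₁ z')) ≤ Re(u* y)`. -/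
theorem hyperbolic_operator_dissipative
    (m : ℕ) (a b : ℝ) (hab : a < b)
    (P₀ : ℝ → Matrix (Fin m) (Fin m) ℂ)
    (hP₀meas : ∀ i j, Measurable fun ξ => P₀ ξ i j)
    (hP₀bdd : ∃ C : ℝ, ∀ ξ ∈ Set.Icc a b, ∀ i j, ‖P₀ ξ i j‖ ≤ C)
    (hP₀diss : ∀ᵐ ξ ∂(volume.restrict (Set.Icc a b)),
      ∀ w : Fin m → ℂ, (star w ⬝ᵥ (P₀ ξ *ᵥ w)).re ≤ 0)
    (P₁ : Matrix (Fin m) (Fin m) ℂ) (hP₁ : P₁.IsHermitian)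
    (W_B W_C : Matrix (Fin m) (Fin m ⊕ Fin m) ℂ)
    (V : Matrix (Fin m ⊕ Fin m) (Fin m ⊕ Fin m) ℂ)
    (hV : V = Matrix.fromRows W_B W_C)
    (Sig : Matrix (Fin m ⊕ Fin m) (Fin m ⊕ Fin m) ℂ)
    (hSig : Sig = Matrix.fromBlocks 0 1 1 0)
    (hWBC : Sig = V * Sig * Vᴴ)
    (z z' : ℝ → (Fin m → ℂ))
    (hz : ∀ ξ ∈ Set.Icc a b, HasDerivAt z (z' ξ) ξ)
    (hz' : ContinuousOn z' (Set.Icc a b))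
    (u y : Fin m → ℂ)
    (hu : u = ((Real.sqrt 2 : ℂ))⁻¹ •
      (W_B *ᵥ (Matrix.fromBlocks P₁ (-P₁) 1 1 *ᵥ Sum.elim (z b) (z a))))
    (hy : y = ((Real.sqrt 2 : ℂ))⁻¹ •
      (W_C *ᵥ (Matrix.fromBlocks P₁ (-P₁) 1 1 *ᵥ Sum.elim (z b) (z a)))) :
    (∫ ξ in a..b, (star (z ξ) ⬝ᵥ (P₀ ξ *ᵥ z ξ + P₁ *ᵥ z' ξ)).re) ≤ (star u ⬝ᵥ y).re := by
  obtain ⟨C, hC⟩ := hP₀bdd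
  have hle : a ≤ b := hab.le
  have hzc : ContinuousOn z (Set.Icc a b) := fun x hx => (hz x hx).continuousAt.continuousWithinAt
  have hzi := fun i => continuousOn_pi.1 hzc i
  have hzi' := fun i => continuousOn_pi.1 hz' i
  have hI1 : IntegrableOn (fun ξ => (star (z ξ) ⬝ᵥ (P₁ *ᵥ z' ξ)).re) (Set.Icc a b) := by
    refine ContinuousOn.integrableOn_Icc ?_
    refine Complex.continuous_re.comp_continuousOn ?_
    simp only [dotProduct, mulVec, Pi.star_apply]
    refine continuousOn_finsetSum _ fun i _ => (hzi i).star.mul ?_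
    exact continuousOn_finsetSum _ fun j _ => continuousOn_const.mul (hzi' j)
  have hI0 : IntegrableOn (fun ξ => (star (z ξ) ⬝ᵥ (P₀ ξ *ᵥ z ξ)).re) (Set.Icc a b) := by
    have : IntegrableOn (fun ξ => star (z ξ) ⬝ᵥ (P₀ ξ *ᵥ z ξ)) (Set.Icc a b) := by
      simp only [dotProduct, mulVec, Pi.star_apply, Finset.mul_sum]
      refine integrable_finsetSum _ fun i _ => integrable_finsetSum _ fun j _ => ?_
      have hP : IntegrableOn (fun ξ => P₀ ξ i j) (Set.Icc a b) :=
        Measure.integrableOn_of_bounded (M := C) (by simp) (hP₀meas i j).aestronglyMeasurable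
          ((ae_restrict_iff' measurableSet_Icc).2 (Filter.Eventually.of_forall
            fun ξ hξ => hC ξ hξ i j))
      exact (hP.mul_continuousOn (hzi j) isCompact_Icc).continuousOn_mul (hzi i).star isCompact_Icc
    exact this.re
  have hmono : (∫ ξ in a..b, (star (z ξ) ⬝ᵥ (P₀ ξ *ᵥ z ξ + P₁ *ᵥ z' ξ)).re)
      ≤ ∫ ξ in a..b, (star (z ξ) ⬝ᵥ (P₁ *ᵥ z' ξ)).re := by
    refine intervalIntegral.integral_mono_ae_restrict hle ?_ ?_ ?_
    · rw [intervalIntegrable_iff_integrableOn_Icc_of_le hle]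
      simp only [dotProduct_add, Complex.add_re]
      exact hI0.add hI1
    · rwa [intervalIntegrable_iff_integrableOn_Icc_of_le hle]
    · filter_upwards [hP₀diss] with ξ hξ
      simp only [dotProduct_add, Complex.add_re]
      linarith [hξ (z ξ)]
  refine hmono.trans (le_of_eq ?_)
  rw [aux_port P₁ hP₁ W_B W_C V hV Sig hSig hWBC (z b) (z a) u y hu hy]
  refine intervalIntegral.integral_eq_sub_of_hasDerivAt
    (f := fun t => (1 / 2 : ℝ) * (star (z t) ⬝ᵥ (P₁ *ᵥ z t)).re) ?_ ?_
  · intro x hx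
    rw [Set.uIcc_of_le hle] at hx
    exact aux_deriv P₁ hP₁ z (z' x) x (hz x hx)
  · rwa [intervalIntegrable_iff_integrableOn_Icc_of_le hle]
end

section
/- Let m ∈ ℕ, let a < b be real numbers, and let H : [a, b] → ℂ^{m×m} be measurable such that H(ξ) is Hermitian positive definite for almost every ξ and both ξ ↦ ‖H(ξ)‖ and ξ ↦ ‖H(ξ)⁻¹‖ are integrable on [a, b]. Then the continuously differentiable functions vanishing at both endpoints are dense in the weighted space X_h* : for every measurable z : [a, b] → ℂ^m with ∫_a^b Re( z(ξ)* H(ξ)⁻¹ z(ξ) ) dξ < ∞ and every ε > 0, there exists φ : ℝ → ℂ^m continuously differentiable on [a, b] with φ(a) = φ(b) = 0 such that ∫_a^b Re( (z(ξ) − φ(ξ))* H(ξ)⁻¹ (z(ξ) − φ(ξ)) ) dξ < ε. -/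
open Matrix MeasureTheory
open scoped ComplexOrder

open Filter Topology in
theorem aux_smooth (m : ℕ) (a b : ℝ) (w : ℝ → ℝ) (hw0 : ∀ ξ, 0 ≤ w ξ)
    (hw : IntegrableOn w (Set.Icc a b)) (z : ℝ → (Fin m → ℂ)) (hz : Measurable z)
    (C : ℝ) (hC : ∀ ξ, ‖z ξ‖ ≤ C) (ε : ℝ) (hε : 0 < ε) :
    ∃ g : ℝ → (Fin m → ℂ), HasCompactSupport g ∧ ContDiff ℝ 1 g ∧
      (∫ ξ in Set.Icc a b, w ξ * ‖z ξ - g ξ‖ ^ 2) ≤ ε := by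
  set μ := (volume.restrict (Set.Icc a b)).withDensity (fun x => ENNReal.ofReal (w x)) with hμ
  have : IsFiniteMeasure μ := isFiniteMeasure_withDensity_ofReal hw.2
  have hzL : MemLp z 2 μ :=
    MemLp.of_bound hz.aestronglyMeasurable C (ae_of_all _ hC)
  obtain ⟨g, hg1, hg2, hg3⟩ := hzL.exist_eLpNorm_sub_le (by norm_num) (by norm_num)
    (Real.sqrt_pos.2 hε)
  have hgL : MemLp g 2 μ := hg2.continuous.memLp_of_hasCompactSupport hg1
  refine ⟨g, hg1, hg2.of_le (by exact_mod_cast le_top), ?_⟩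
  rw [(hzL.sub hgL).eLpNorm_eq_integral_rpow_norm (by norm_num) (by norm_num),
    ENNReal.ofReal_le_ofReal_iff (Real.sqrt_nonneg _)] at hg3
  have e : (∫ x, ‖(z - g) x‖ ^ (2 : ENNReal).toReal ∂μ)
      = ∫ ξ in Set.Icc a b, w ξ * ‖z ξ - g ξ‖ ^ 2 := by
    rw [hμ, integral_withDensity_eq_integral_toReal_smul₀
      (hw.1.aemeasurable.ennreal_ofReal) (ae_of_all _ fun x => ENNReal.ofReal_lt_top)]
    refine integral_congr_ae (ae_of_all _ fun x => ?_)
    simp [ENNReal.toReal_ofReal (hw0 x)]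
  rw [e] at hg3
  have h2 : ((2 : ENNReal).toReal)⁻¹ = 1 / 2 := by norm_num
  rw [h2, ← Real.sqrt_eq_rpow, Real.sqrt_le_sqrt_iff hε.le] at hg3
  exact hg3

open Filter Topology in
theorem aux_cutoff (m : ℕ) (a b : ℝ) (hab : a < b) (w : ℝ → ℝ) (hw0 : ∀ ξ, 0 ≤ w ξ)
    (hw : IntegrableOn w (Set.Icc a b)) (g : ℝ → (Fin m → ℂ)) (hg : Continuous g)
    (C : ℝ) (hC : ∀ ξ, ‖g ξ‖ ≤ C) (ε : ℝ) (hε : 0 < ε) :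
    ∃ χ : ℝ → ℝ, ContDiff ℝ 1 χ ∧ χ a = 0 ∧ χ b = 0 ∧
      IntegrableOn (fun ξ => w ξ * ‖g ξ - χ ξ • g ξ‖ ^ 2) (Set.Icc a b) ∧
      (∫ ξ in Set.Icc a b, w ξ * ‖g ξ - χ ξ • g ξ‖ ^ 2) < ε := by
  let q : ℝ → ℝ := fun ξ => 1 - (ξ - a) * (b - ξ) / (b - a) ^ 2
  have hba : 0 < b - a := sub_pos.2 hab
  have hq0 : ∀ ξ ∈ Set.Icc a b, 0 ≤ q ξ := by
    intro ξ hξ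
    have : (ξ - a) * (b - ξ) / (b - a) ^ 2 ≤ 1 := by
      rw [div_le_one (by positivity)]
      nlinarith [hξ.1, hξ.2]
    simp only [q]; linarith
  have hq1 : ∀ ξ ∈ Set.Icc a b, q ξ ≤ 1 := by
    intro ξ hξ
    have : 0 ≤ (ξ - a) * (b - ξ) / (b - a) ^ 2 :=
      div_nonneg (mul_nonneg (sub_nonneg.2 hξ.1) (sub_nonneg.2 hξ.2)) (by positivity)
    simp only [q]; linarith
  have hq1' : ∀ ξ ∈ Set.Ioo a b, q ξ < 1 := by
    intro ξ hξ
    have : 0 < (ξ - a) * (b - ξ) / (b - a) ^ 2 :=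
      div_pos (mul_pos (sub_pos.2 hξ.1) (sub_pos.2 hξ.2)) (by positivity)
    simp only [q]; linarith
  have hqc : ContDiff ℝ 1 q := by fun_prop
  have hnorm : ∀ n : ℕ, ∀ ξ ∈ Set.Icc a b,
      ‖g ξ - (1 - q ξ ^ n) • g ξ‖ = q ξ ^ n * ‖g ξ‖ := by
    intro n ξ hξ
    have : g ξ - (1 - q ξ ^ n) • g ξ = (q ξ ^ n) • g ξ := by module
    rw [this, norm_smul, Real.norm_of_nonneg (pow_nonneg (hq0 ξ hξ) n)]
  have hmeas : ∀ n : ℕ, AEStronglyMeasurable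
      (fun ξ => w ξ * ‖g ξ - (1 - q ξ ^ n) • g ξ‖ ^ 2) (volume.restrict (Set.Icc a b)) := by
    intro n
    refine hw.1.mul (Continuous.aestronglyMeasurable ?_)
    have := hqc.continuous
    fun_prop
  have hbi : Integrable (fun ξ => w ξ * C ^ 2) (volume.restrict (Set.Icc a b)) :=
    Integrable.mul_const hw _
  have hbound : ∀ n : ℕ, ∀ᵐ ξ ∂(volume.restrict (Set.Icc a b)),
      ‖w ξ * ‖g ξ - (1 - q ξ ^ n) • g ξ‖ ^ 2‖ ≤ w ξ * C ^ 2 := by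
    intro n
    filter_upwards [ae_restrict_mem measurableSet_Icc] with ξ hξ
    rw [Real.norm_of_nonneg (mul_nonneg (hw0 ξ) (by positivity)), hnorm n ξ hξ]
    have h1 : q ξ ^ n ≤ 1 := pow_le_one₀ (hq0 ξ hξ) (hq1 ξ hξ)
    have h0 : 0 ≤ q ξ ^ n := pow_nonneg (hq0 ξ hξ) n
    have h2 : q ξ ^ n * ‖g ξ‖ ≤ C :=
      (mul_le_of_le_one_left (norm_nonneg _) h1).trans (hC ξ)
    gcongr
    exact hw0 ξ
  have hlim : ∀ᵐ ξ ∂(volume.restrict (Set.Icc a b)),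
      Tendsto (fun n : ℕ => w ξ * ‖g ξ - (1 - q ξ ^ n) • g ξ‖ ^ 2) atTop (𝓝 0) := by
    rw [← restrict_Ioo_eq_restrict_Icc]
    filter_upwards [ae_restrict_mem measurableSet_Ioo] with ξ hξ
    have hξ' := Set.Ioo_subset_Icc_self hξ
    have := tendsto_pow_atTop_nhds_zero_of_lt_one (hq0 ξ hξ') (hq1' ξ hξ)
    have h3 := ((this.mul_const ‖g ξ‖).pow 2).const_mul (w ξ)
    simp only [zero_mul, ne_eq, OfNat.ofNat_ne_zero, not_false_eq_true, zero_pow, mul_zero] at h3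
    refine h3.congr fun n => ?_
    rw [hnorm n ξ hξ']
  have hT := tendsto_integral_of_dominated_convergence _ hmeas hbi hbound hlim
  rw [integral_zero] at hT
  obtain ⟨n, hn, hn1⟩ := ((hT.eventually_lt_const hε).and (eventually_ge_atTop 1)).exists
  refine ⟨fun ξ => 1 - q ξ ^ n, contDiff_const.sub (hqc.pow n), ?_, ?_, ?_, hn⟩
  · simp [q]
  · simp [q]
  · exact Integrable.mono' hbi (hmeas n) (hbound n)

theorem aux_bound {m : ℕ} (A : Matrix (Fin m) (Fin m) ℂ) (v : Fin m → ℂ) :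
    (star v ⬝ᵥ (A *ᵥ v)).re ≤ (∑ i, ∑ j, ‖A i j‖) * ‖v‖ ^ 2 := by
  refine (Complex.re_le_norm _).trans ?_
  simp only [dotProduct, mulVec]
  rw [Finset.sum_mul]
  refine (norm_sum_le _ _).trans (Finset.sum_le_sum fun i _ => ?_)
  rw [Finset.mul_sum, Finset.sum_mul]
  refine (norm_sum_le _ _).trans (Finset.sum_le_sum fun j _ => ?_)
  simp only [norm_mul, Pi.star_apply, norm_star]
  have h1 := norm_le_pi_norm v i
  have h2 := norm_le_pi_norm v j
  calc ‖v i‖ * (‖A i j‖ * ‖v j‖) ≤ ‖v‖ * (‖A i j‖ * ‖v‖) := by gcongr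
    _ = _ := by ring

theorem aux_par {m : ℕ} (A : Matrix (Fin m) (Fin m) ℂ) (hA : A.PosSemidef) (u v : Fin m → ℂ) :
    (star (u + v) ⬝ᵥ (A *ᵥ (u + v))).re
      ≤ 2 * (star u ⬝ᵥ (A *ᵥ u)).re + 2 * (star v ⬝ᵥ (A *ᵥ v)).re := by
  have h : 0 ≤ (star (u - v) ⬝ᵥ (A *ᵥ (u - v))).re :=
    (Complex.le_def.1 (hA.dotProduct_mulVec_nonneg (u - v))).1
  simp only [star_add, star_sub, mulVec_add, mulVec_sub, add_dotProduct, sub_dotProduct,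
    dotProduct_add, dotProduct_sub, Complex.add_re, Complex.sub_re] at h ⊢
  linarith

set_option maxHeartbeats 1000000 in
open Filter Topology in
/-- Let `H : [a, b] → ℂ^{m×m}` be measurable and a.e. Hermitian positive
definite with both `H` and `H⁻¹` (entrywise) integrable. Then the continuously
differentiable functions vanishing at both endpoints are dense in the weighted space
`X_h* = H^{1/2}·L²`: for every measurable `z` with `∫_a^b Re(z* H⁻¹ z) < ∞` and every
`ε > 0` there is `φ`, continuously differentiable on `[a, b]` with `φ(a) = φ(b) = 0`,
such that `∫_a^b Re((z − φ)* H⁻¹ (z − φ)) < ε`. -/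
theorem smooth_compactly_supported_dense_in_weighted_space
    (m : ℕ) (a b : ℝ) (hab : a < b)
    (H : ℝ → Matrix (Fin m) (Fin m) ℂ)
    (hHmeas : ∀ i j, Measurable fun ξ => H ξ i j)
    (hHpos : ∀ᵐ ξ ∂(volume.restrict (Set.Icc a b)), (H ξ).PosDef)
    (hHint : ∀ i j, IntegrableOn (fun ξ => ‖H ξ i j‖) (Set.Icc a b))
    (hHinvint : ∀ i j, IntegrableOn (fun ξ => ‖(H ξ)⁻¹ i j‖) (Set.Icc a b))
    (z : ℝ → (Fin m → ℂ)) (hzmeas : Measurable z)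
    (hz : IntegrableOn (fun ξ => (star (z ξ) ⬝ᵥ ((H ξ)⁻¹ *ᵥ z ξ)).re) (Set.Icc a b))
    (ε : ℝ) (hε : 0 < ε) :
    ∃ φ : ℝ → (Fin m → ℂ),
      ContDiffOn ℝ 1 φ (Set.Icc a b) ∧ φ a = 0 ∧ φ b = 0 ∧
      (∫ ξ in Set.Icc a b, (star (z ξ - φ ξ) ⬝ᵥ ((H ξ)⁻¹ *ᵥ (z ξ - φ ξ))).re) < ε := by
  set Q : ℝ → (Fin m → ℂ) → ℝ := fun ξ v => (star v ⬝ᵥ ((H ξ)⁻¹ *ᵥ v)).re with hQ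
  set w : ℝ → ℝ := fun ξ => ∑ i, ∑ j, ‖(H ξ)⁻¹ i j‖ with hwdef
  have hw0 : ∀ ξ, 0 ≤ w ξ := fun ξ => by positivity
  have hw : IntegrableOn w (Set.Icc a b) :=
    integrable_finsetSum _ fun i _ => integrable_finsetSum _ fun j _ => hHinvint i j
  have hQnn : ∀ᵐ ξ ∂(volume.restrict (Set.Icc a b)), ∀ v, 0 ≤ Q ξ v := by
    filter_upwards [hHpos] with ξ hξ v
    exact (Complex.le_def.1 (hξ.inv.posSemidef.dotProduct_mulVec_nonneg v)).1
  have hQpar : ∀ᵐ ξ ∂(volume.restrict (Set.Icc a b)), ∀ u v,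
      Q ξ (u + v) ≤ 2 * Q ξ u + 2 * Q ξ v := by
    filter_upwards [hHpos] with ξ hξ u v
    exact aux_par _ hξ.inv.posSemidef u v
  -- truncation
  have hset : ∀ n : ℕ, MeasurableSet {ξ | (n : ℝ) < ‖z ξ‖} := fun n =>
    measurableSet_lt measurable_const hzmeas.norm
  let T : ℕ → ℝ → (Fin m → ℂ) := fun n => {ξ | (n : ℝ) < ‖z ξ‖}.indicator z
  have hQT : ∀ n ξ, Q ξ (T n ξ) = {ξ | (n : ℝ) < ‖z ξ‖}.indicator (fun ξ => Q ξ (z ξ)) ξ := by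
    intro n ξ
    by_cases h : ξ ∈ {ξ | (n : ℝ) < ‖z ξ‖}
    · simp only [T, Set.indicator_of_mem h]
    · simp only [T, Set.indicator_of_notMem h]
      simp [hQ]
  have hTint : ∀ n, IntegrableOn (fun ξ => Q ξ (T n ξ)) (Set.Icc a b) := by
    intro n
    simp only [hQT]
    exact Integrable.indicator hz (hset n)
  have hTlim : Tendsto (fun n => ∫ ξ in Set.Icc a b, Q ξ (T n ξ)) atTop (𝓝 0) := by
    have := tendsto_integral_of_dominated_convergence (μ := volume.restrict (Set.Icc a b))
      (F := fun n ξ => Q ξ (T n ξ)) (f := fun _ => (0 : ℝ)) (fun ξ => Q ξ (z ξ))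
      (fun n => (hTint n).1) hz ?_ ?_
    · simpa using this
    · intro n
      filter_upwards [hQnn] with ξ hξ
      rw [Real.norm_of_nonneg (hξ _), hQT]
      by_cases h : ξ ∈ {ξ | (n : ℝ) < ‖z ξ‖}
      · rw [Set.indicator_of_mem h]
      · rw [Set.indicator_of_notMem h]
        exact hξ _
    · refine ae_of_all _ fun ξ => ?_
      obtain ⟨N, hN⟩ := exists_nat_ge ‖z ξ‖
      refine tendsto_const_nhds.congr' ?_
      filter_upwards [eventually_ge_atTop N] with n hn
      rw [hQT, Set.indicator_of_notMem]
      simp only [Set.mem_ofPred_eq, not_lt]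
      exact hN.trans (by exact_mod_cast hn)
  obtain ⟨N, hN⟩ := (hTlim.eventually_lt_const (show 0 < ε / 8 by positivity)).exists
  let y : ℝ → (Fin m → ℂ) := fun ξ => z ξ - T N ξ
  have hymeas : Measurable y := hzmeas.sub (hzmeas.indicator (hset N))
  have hyb : ∀ ξ, ‖y ξ‖ ≤ N := by
    intro ξ
    by_cases h : ξ ∈ {ξ | (N : ℝ) < ‖z ξ‖}
    · simp only [y, T, Set.indicator_of_mem h]
      simp
    · simp only [y, T, Set.indicator_of_notMem h]
      simpa using h
  obtain ⟨g, hg1, hg2, hg3⟩ := aux_smooth m a b w hw0 hw y hymeas N hyb (ε / 16) (by positivity)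
  obtain ⟨C, hC⟩ := hg1.exists_bound_of_continuous hg2.continuous
  obtain ⟨χ, hχ, hχa, hχb, hχi, hχε⟩ := aux_cutoff m a b hab w hw0 hw g hg2.continuous C hC
    (ε / 16) (by positivity)
  refine ⟨fun ξ => χ ξ • g ξ, (hχ.smul hg2).contDiffOn, by simp [hχa], by simp [hχb], ?_⟩
  have hygi : IntegrableOn (fun ξ => w ξ * ‖y ξ - g ξ‖ ^ 2) (Set.Icc a b) := by
    refine Integrable.mono' (Integrable.mul_const hw ((N + C) ^ 2)) ?_ (ae_of_all _ fun ξ => ?_)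
    · exact hw.1.mul ((hymeas.sub hg2.continuous.measurable).norm.pow_const
        2).aestronglyMeasurable
    · rw [Real.norm_of_nonneg (mul_nonneg (hw0 ξ) (by positivity))]
      have : ‖y ξ - g ξ‖ ≤ N + C := (norm_sub_le _ _).trans (add_le_add (hyb ξ) (hC ξ))
      gcongr
  have hGi : IntegrableOn (fun ξ => 2 * Q ξ (T N ξ) + (4 * (w ξ * ‖y ξ - g ξ‖ ^ 2)
      + 4 * (w ξ * ‖g ξ - χ ξ • g ξ‖ ^ 2))) (Set.Icc a b) :=
    ((hTint N).const_mul 2).add ((hygi.const_mul 4).add (hχi.const_mul 4))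
  have hle : (∫ ξ in Set.Icc a b, Q ξ (z ξ - χ ξ • g ξ)) ≤
      ∫ ξ in Set.Icc a b, (2 * Q ξ (T N ξ) + (4 * (w ξ * ‖y ξ - g ξ‖ ^ 2)
      + 4 * (w ξ * ‖g ξ - χ ξ • g ξ‖ ^ 2))) := by
    refine integral_mono_of_nonneg ?_ hGi ?_
    · filter_upwards [hQnn] with ξ hξ using hξ _
    · filter_upwards [hQpar] with ξ hξ
      have h1 := hξ (T N ξ) ((y ξ - g ξ) + (g ξ - χ ξ • g ξ))
      have h2 := hξ (y ξ - g ξ) (g ξ - χ ξ • g ξ)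
      have h3 : Q ξ (y ξ - g ξ) ≤ w ξ * ‖y ξ - g ξ‖ ^ 2 := aux_bound _ _
      have h4 : Q ξ (g ξ - χ ξ • g ξ) ≤ w ξ * ‖g ξ - χ ξ • g ξ‖ ^ 2 := aux_bound _ _
      have e : T N ξ + ((y ξ - g ξ) + (g ξ - χ ξ • g ξ)) = z ξ - χ ξ • g ξ := by
        simp only [y]; abel
      rw [e] at h1
      linarith
  have hsum : IntegrableOn (fun ξ => 4 * (w ξ * ‖y ξ - g ξ‖ ^ 2)
      + 4 * (w ξ * ‖g ξ - χ ξ • g ξ‖ ^ 2)) (Set.Icc a b) :=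
    (hygi.const_mul 4).add (hχi.const_mul 4)
  rw [integral_add ((hTint N).const_mul 2) hsum,
    integral_add (hygi.const_mul 4) (hχi.const_mul 4), integral_const_mul, integral_const_mul,
    integral_const_mul] at hle
  change (∫ ξ in Set.Icc a b, Q ξ (z ξ - χ ξ • g ξ)) < ε
  linarith
end

section
/- Let m ∈ ℕ and a < b be real numbers. Let H : [a, b] → ℂ^{m×m} be measurable such that H(ξ) is Hermitian positive definite for almost every ξ and both ξ ↦ ‖H(ξ)‖ and ξ ↦ ‖H(ξ)⁻¹‖ are integrable on [a, b]. Let P₀ : [a, b] → ℂ^{m×m} be measurable and bounded with, for almost every ξ, Re(w* P₀(ξ) w) ≤ 0 for all w ∈ ℂ^m; let P₁ ∈ ℂ^{m×m} be Hermitian and invertible; and let W_B, W_C ∈ ℂ^{m×2m} satisfy Σ = V Σ V* with Σ := [[0, I_m],[I_m, 0]] and V := [[W_B],[W_C]]. Suppose z : [a, b] → ℂ^m is measurable with ∫_a^b Re( z(ξ)* H(ξ)⁻¹ z(ξ) ) dξ < ∞, and suppose that for every φ : ℝ → ℂ^m that is continuously differentiable on [a, b] and satisfies the boundary condition W_B·[[P₁,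 −P₁],[I_m, I_m]]·(φ(b), φ(a)) = 0, one has ∫_a^b ( P₀(ξ) φ(ξ) + P₁ φ'(ξ) − H(ξ)⁻¹ φ(ξ) )* z(ξ) dξ = 0. Then z = 0 almost everywhere on [a, b]. (Equivalently: the set {P₀ φ + P₁ φ' − H⁻¹ φ : φ as above} is dense in the weighted space X_h with norm ‖x‖²_{X_h} = ∫ x* H x.) -/
open Matrix MeasureTheory
open scoped ComplexOrder

lemma ac_const (c : ℂ) (a b : ℝ) : AbsolutelyContinuousOnInterval (fun _ : ℝ => c) a b :=
  ((LipschitzWith.const c).lipschitzOnWith).absolutelyContinuousOnInterval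

lemma ac_congr {f g : ℝ → ℂ} {a b : ℝ} (hf : AbsolutelyContinuousOnInterval f a b)
    (h : ∀ x ∈ Set.uIcc a b, f x = g x) : AbsolutelyContinuousOnInterval g a b := by
  rw [absolutelyContinuousOnInterval_iff] at hf ⊢
  intro ε hε
  obtain ⟨δ, hδ, H⟩ := hf ε hε
  refine ⟨δ, hδ, fun E hE hs => ?_⟩
  have := H E hE hs
  refine lt_of_le_of_lt (le_of_eq ?_) this
  refine Finset.sum_congr rfl fun i hi => ?_
  rw [h _ (hE.1 i hi).1, h _ (hE.1 i hi).2]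

lemma ac_primitive {f : ℝ → ℂ} {a b : ℝ} (h : IntervalIntegrable f volume a b) :
    AbsolutelyContinuousOnInterval (fun x => ∫ v in a..x, f v) a b := by
  have hI : IntegrableOn f (Set.uIoc a b) := intervalIntegrable_iff.1 h
  have hre : IntervalIntegrable (fun x => (f x).re) volume a b := intervalIntegrable_iff.2 hI.re
  have him : IntervalIntegrable (fun x => (f x).im) volume a b := intervalIntegrable_iff.2 hI.im
  have h1 := (hre.absolutelyContinuousOnInterval_intervalIntegral (c := a) (by simp)).smul
    (ac_const 1 a b)
  have h2 := (him.absolutelyContinuousOnInterval_intervalIntegral (c := a) (by simp)).smul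
    (ac_const Complex.I a b)
  have h3 := h1.add h2
  refine ac_congr h3 ?_
  intro x hx
  have hx' : IntervalIntegrable f volume a x :=
    h.mono_set (Set.uIcc_subset_uIcc (by simp) hx)
  have e1 : (∫ v in a..x, (f v).re) = (∫ v in a..x, f v).re :=
    Complex.reCLM.intervalIntegral_comp_comm hx'
  have e2 : (∫ v in a..x, (f v).im) = (∫ v in a..x, f v).im :=
    Complex.imCLM.intervalIntegral_comp_comm hx'
  simp only [Pi.add_apply, Pi.smul_apply', e1, e2]
  simp

lemma by_parts {f g : ℝ → ℂ} {a b : ℝ} (hf : IntervalIntegrable f volume a b)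
    (hg : IntervalIntegrable g volume a b) (α β : ℂ) :
    ∫ x in a..b, (f x * (β + ∫ v in a..x, g v) + (α + ∫ v in a..x, f v) * g x) =
      (α + ∫ v in a..b, f v) * (β + ∫ v in a..b, g v) - α * β := by
  set F : ℝ → ℂ := fun x => α + ∫ v in a..x, f v with hF
  set G : ℝ → ℂ := fun x => β + ∫ v in a..x, g v with hG
  have aF : AbsolutelyContinuousOnInterval F a b := (ac_const α a b).add (ac_primitive hf)
  have aG : AbsolutelyContinuousOnInterval G a b := (ac_const β a b).add (ac_primitive hg)
  have hk : IntervalIntegrable (fun x => f x * G x + F x * g x) volume a b :=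
    (hf.mul_continuousOn aG.continuousOn).add (hg.continuousOn_mul aF.continuousOn)
  have aK := (aF.smul aG).sub (ac_primitive hk)
  obtain ⟨C, hC⟩ := aK.const_of_ae_hasDerivAt_zero (by
    filter_upwards [hf.ae_hasDerivAt_integral, hg.ae_hasDerivAt_integral,
      hk.ae_hasDerivAt_integral] with x h1 h2 h3 hx
    have e1 := (h1 hx a (by simp)).const_add α
    have e2 := (h2 hx a (by simp)).const_add β
    have e3 := h3 hx a (by simp)
    have := (e1.mul e2).sub e3
    rw [sub_eq_zero.2 rfl] at this
    exact this)
  have hb := hC b (by simp)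
  have ha := hC a (by simp)
  have Fa : F a = α := by simp [F]
  have Ga : G a = β := by simp [G]
  have Fb : F b = α + ∫ v in a..b, f v := rfl
  have Gb : G b = β + ∫ v in a..b, g v := rfl
  simp only [Pi.sub_apply, smul_eq_mul, intervalIntegral.integral_same, Pi.mul_apply, Fa, Ga]
    at ha hb
  rw [← ha] at hb
  rw [← Fb, ← Gb]
  linear_combination -hb

lemma du_bois_reymond {u h : ℝ → ℂ} {a b : ℝ} (hab : a < b)
    (hu : IntervalIntegrable u volume a b) (hh : IntervalIntegrable h volume a b)
    (H : ∀ ψ : ℝ → ℂ, Continuous ψ → (∫ x in a..b, ψ x) = 0 →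
      ∫ x in a..b, ((∫ v in a..x, ψ v) * h x + ψ x * u x) = 0) :
    ∃ c : ℂ, ∀ᵐ x ∂(volume.restrict (Set.Icc a b)), u x = c + ∫ v in a..x, h v := by
  set G : ℝ → ℂ := fun x => ∫ v in a..x, h v with hG
  have hGc : ContinuousOn G (Set.uIcc a b) := (ac_primitive hh).continuousOn
  have hGi : IntervalIntegrable G volume a b := hGc.intervalIntegrable
  set w : ℝ → ℂ := fun x => u x - G x with hw
  have hwi : IntervalIntegrable w volume a b := hu.sub hGi
  set c : ℂ := (∫ x in a..b, w x) / (b - a) with hc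
  have hba : (b - a : ℂ) ≠ 0 := by
    rw [sub_ne_zero]; exact_mod_cast hab.ne'
  have key : ∀ ψ : ℝ → ℂ, Continuous ψ → ∫ x in a..b, ψ x * (w x - c) = 0 := by
    intro ψ hψ
    set μ : ℂ := (∫ x in a..b, ψ x) / (b - a) with hμ
    have hψi : IntervalIntegrable ψ volume a b := hψ.intervalIntegrable _ _
    have hψm : Continuous fun x => ψ x - μ := hψ.sub continuous_const
    have hψmi : IntervalIntegrable (fun x => ψ x - μ) volume a b := hψm.intervalIntegrable _ _
    have h0 : (∫ x in a..b, (ψ x - μ)) = 0 := by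
      rw [intervalIntegral.integral_sub hψi (by simp)]
      simp only [intervalIntegral.integral_const, Complex.real_smul, hμ]
      push_cast
      field_simp
      ring
    have h1 := H _ hψm h0
    have h2 := by_parts hψmi hh 0 0
    simp only [zero_add, h0, zero_mul, sub_zero, mul_zero] at h2
    have hPc : ContinuousOn (fun x => ∫ v in a..x, (ψ v - μ)) (Set.uIcc a b) :=
      (ac_primitive hψmi).continuousOn
    have i1 := hh.continuousOn_mul hPc
    have i2 := hu.continuousOn_mul hψm.continuousOn
    have i3 := hGi.continuousOn_mul hψm.continuousOn
    rw [intervalIntegral.integral_add i1 i2] at h1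
    rw [intervalIntegral.integral_add i3 i1] at h2
    have h3 : ∫ x in a..b, (ψ x - μ) * w x = 0 := by
      have : (fun x => (ψ x - μ) * w x) = fun x => (ψ x - μ) * u x - (ψ x - μ) * G x := by
        funext x; simp only [hw]; ring
      rw [this, intervalIntegral.integral_sub i2 i3]
      linear_combination h1 - h2
    have i4 := hwi.continuousOn_mul hψ.continuousOn
    have h4 : (∫ x in a..b, ψ x * w x) - μ * ∫ x in a..b, w x = 0 := by
      rw [← h3, ← intervalIntegral.integral_const_mul,
        ← intervalIntegral.integral_sub i4 (hwi.const_mul μ)]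
      congr 1; funext x; ring
    have : (fun x => ψ x * (w x - c)) = fun x => ψ x * w x - c * ψ x := by
      funext x; ring
    rw [this, intervalIntegral.integral_sub i4 (hψi.const_mul c),
      intervalIntegral.integral_const_mul, ← h4, hc, hμ]
    ring
  refine ⟨c, ?_⟩
  have hio : IntegrableOn (fun x => w x - c) (Set.Ioo a b) := by
    have := hwi.sub (intervalIntegrable_const (c := c) (μ := volume) (a := a) (b := b))
    rw [intervalIntegrable_iff_integrableOn_Ioo_of_le hab.le] at this
    exact this
  have hz := isOpen_Ioo.ae_eq_zero_of_integral_contDiff_smul_eq_zero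
    (f := fun x => w x - c) (μ := volume) (U := Set.Ioo a b) hio.locallyIntegrableOn (by
      intro g hg _ hsupp
      have := key (fun x => (g x : ℂ)) (Complex.continuous_ofReal.comp hg.continuous)
      rw [intervalIntegral.integral_of_le hab.le, integral_Ioc_eq_integral_Ioo] at this
      rw [← this, eq_comm]
      refine setIntegral_eq_integral_of_forall_compl_eq_zero fun x hx => ?_
      have : g x = 0 := by
        by_contra hne
        exact hx (hsupp (subset_tsupport g hne))
      simp [this])
  rw [← restrict_Ioo_eq_restrict_Icc, ae_restrict_iff' measurableSet_Ioo]
  filter_upwards [hz] with x hx hx'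
  have := hx hx'
  simp only [hw] at this
  linear_combination this

lemma measurable_inv_entry {m : ℕ} {H : ℝ → Matrix (Fin m) (Fin m) ℂ}
    (hH : ∀ i j, Measurable fun ξ => H ξ i j) (i j : Fin m) :
    Measurable fun ξ => (H ξ)⁻¹ i j := by
  have hdet : ∀ K : ℝ → Matrix (Fin m) (Fin m) ℂ, (∀ i j, Measurable fun ξ => K ξ i j) →
      Measurable fun ξ => (K ξ).det := by
    intro K hK
    simp only [Matrix.det_apply]
    refine Finset.measurable_sum _ fun σ _ => ?_
    refine Measurable.const_smul ?_ _
    exact Finset.measurable_prod _ fun k _ => hK _ _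
  simp only [Matrix.inv_def, Matrix.smul_apply, Ring.inverse_eq_inv', smul_eq_mul,
    Matrix.adjugate_apply]
  refine (hdet H hH).inv.mul (hdet _ ?_)
  intro k l
  by_cases hk : k = j
  · subst hk; simp
  · simp only [Matrix.updateRow_ne hk]; exact hH k l

lemma psd_cs {m : ℕ} {N : Matrix (Fin m) (Fin m) ℂ} (hN : N.PosSemidef) (w z : Fin m → ℂ) :
    ‖star w ⬝ᵥ (N *ᵥ z)‖ ≤ (star w ⬝ᵥ (N *ᵥ w)).re + (star z ⬝ᵥ (N *ᵥ z)).re := by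
  have herm : star z ⬝ᵥ (N *ᵥ w) = star (star w ⬝ᵥ (N *ᵥ z)) := by
    rw [← Matrix.star_dotProduct_star, star_star, Matrix.star_mulVec, hN.isHermitian.eq,
      dotProduct_comm, ← Matrix.dotProduct_mulVec, dotProduct_comm]
  have h : ∀ θ : ℂ, 0 ≤ (star (w + θ • z) ⬝ᵥ (N *ᵥ (w + θ • z))).re := fun θ =>
    (Complex.le_def.1 (hN.dotProduct_mulVec_nonneg (w + θ • z))).1
  set s := star w ⬝ᵥ (N *ᵥ z)
  have e : ∀ θ : ℂ, star (w + θ • z) ⬝ᵥ (N *ᵥ (w + θ • z)) =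
      star w ⬝ᵥ (N *ᵥ w) + θ * s + star θ * star s + (star θ * θ) * (star z ⬝ᵥ (N *ᵥ z)) := by
    intro θ
    simp only [star_add, star_smul, Matrix.mulVec_add, Matrix.mulVec_smul, add_dotProduct,
      dotProduct_add, smul_dotProduct, dotProduct_smul, herm, smul_eq_mul]
    ring
  simp only [e] at h
  have h1 := h 1
  have h2 := h (-1)
  have h3 := h Complex.I
  have h4 := h (-Complex.I)
  simp at h1 h2 h3 h4
  have := Complex.norm_le_abs_re_add_abs_im s
  have r : |s.re| ≤ ((star w ⬝ᵥ (N *ᵥ w)).re + (star z ⬝ᵥ (N *ᵥ z)).re) / 2 := by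
    rw [abs_le]; constructor <;> linarith
  have i : |s.im| ≤ ((star w ⬝ᵥ (N *ᵥ w)).re + (star z ⬝ᵥ (N *ᵥ z)).re) / 2 := by
    rw [abs_le]; constructor <;> linarith
  linarith

lemma bound_inv {m : ℕ} {H : Matrix (Fin m) (Fin m) ℂ} (hH : H.PosDef) (z : Fin m → ℂ)
    (i : Fin m) : ‖(H⁻¹ *ᵥ z) i‖ ≤ ‖H⁻¹ i i‖ + (star z ⬝ᵥ (H⁻¹ *ᵥ z)).re := by
  have h := psd_cs hH.inv.posSemidef (Pi.single i 1) z
  have e : star (Pi.single i 1 : Fin m → ℂ) = Pi.single i 1 := by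
    ext k; by_cases hk : k = i
    · subst hk; simp
    · simp [hk]
  rw [e] at h
  simp only [single_dotProduct, one_mul, Matrix.mulVec_single_one] at h
  have := Complex.re_le_norm (H⁻¹ i i)
  simp only [Matrix.col_apply] at h
  linarith

lemma bound_id {m : ℕ} {H : Matrix (Fin m) (Fin m) ℂ} (hH : H.PosDef) (z : Fin m → ℂ)
    (i : Fin m) : ‖z i‖ ≤ ‖H i i‖ + (star z ⬝ᵥ (H⁻¹ *ᵥ z)).re := by
  have h := psd_cs hH.inv.posSemidef (H *ᵥ Pi.single i 1) z
  have e : star (Pi.single i 1 : Fin m → ℂ) = Pi.single i 1 := by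
    ext k; by_cases hk : k = i
    · subst hk; simp
    · simp [hk]
  have hu : IsUnit H.det := (Matrix.isUnit_iff_isUnit_det _).1 hH.isUnit
  have e2 : ∀ y : Fin m → ℂ, star (H *ᵥ Pi.single i 1) ⬝ᵥ (H⁻¹ *ᵥ y) = y i := by
    intro y
    rw [Matrix.star_mulVec, hH.isHermitian.eq, ← Matrix.dotProduct_mulVec, Matrix.mulVec_mulVec,
      Matrix.mul_nonsing_inv _ hu, Matrix.one_mulVec, e]
    simp
  rw [e2, e2] at h
  simp only [Matrix.mulVec_single_one, Matrix.col_apply] at h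
  have := Complex.re_le_norm (H i i)
  linarith

lemma boundary {m : ℕ} (P₁ : Matrix (Fin m) (Fin m) ℂ) (hP₁ : P₁.IsHermitian)
    (hP₁inv : IsUnit P₁)
    (W_B W_C : Matrix (Fin m) (Fin m ⊕ Fin m) ℂ)
    (V : Matrix (Fin m ⊕ Fin m) (Fin m ⊕ Fin m) ℂ)
    (hV : V = Matrix.fromRows W_B W_C)
    (Sig : Matrix (Fin m ⊕ Fin m) (Fin m ⊕ Fin m) ℂ)
    (hSig : Sig = Matrix.fromBlocks 0 1 1 0)
    (hWBC : Sig = V * Sig * Vᴴ) (zb za : Fin m → ℂ)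
    (h : ∀ p q : Fin m → ℂ,
      W_B *ᵥ (Matrix.fromBlocks P₁ (-P₁) 1 1 *ᵥ Sum.elim p q) = 0 →
      star p ⬝ᵥ (P₁ *ᵥ zb) - star q ⬝ᵥ (P₁ *ᵥ za) = 0) :
    star zb ⬝ᵥ (P₁ *ᵥ zb) - star za ⬝ᵥ (P₁ *ᵥ za) = 0 := by
  apply h
  set g := (Matrix.fromBlocks P₁ (-P₁) 1 1 : Matrix (Fin m ⊕ Fin m) (Fin m ⊕ Fin m) ℂ) *ᵥ Sum.elim zb za with hg
  have hB : W_B * Sig * W_Bᴴ = 0 := by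
    have := congrArg Matrix.toBlocks₁₁ hWBC
    rw [hV, Matrix.conjTranspose_fromRows_eq_fromCols_conjTranspose, Matrix.fromRows_mul,
      Matrix.fromRows_mul_fromCols, Matrix.toBlocks_fromBlocks₁₁] at this
    rw [← this, hSig, Matrix.toBlocks_fromBlocks₁₁]
  have hdet : IsUnit P₁.det := (Matrix.isUnit_iff_isUnit_det _).1 hP₁inv
  have key : ∀ y : Fin m → ℂ, star y ⬝ᵥ (W_B *ᵥ g) = 0 := by
    intro y
    set f := Sig *ᵥ (W_Bᴴ *ᵥ y) with hf
    have hWf : W_B *ᵥ f = 0 := by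
      rw [hf, Matrix.mulVec_mulVec, Matrix.mulVec_mulVec, hB,
        Matrix.zero_mulVec]
    set f1 : Fin m → ℂ := fun i => f (Sum.inl i) with hf1
    set f2 : Fin m → ℂ := fun i => f (Sum.inr i) with hf2
    have hf12 : f = Sum.elim f1 f2 := by ext k; cases k <;> rfl
    set p : Fin m → ℂ := (1/2 : ℂ) • (f2 + P₁⁻¹ *ᵥ f1) with hp
    set q : Fin m → ℂ := (1/2 : ℂ) • (f2 - P₁⁻¹ *ᵥ f1) with hq
    have hpq1 : P₁ *ᵥ p - P₁ *ᵥ q = f1 := by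
      rw [← Matrix.mulVec_sub]
      have : p - q = P₁⁻¹ *ᵥ f1 := by
        ext i; simp [hp, hq]; ring
      rw [this, Matrix.mulVec_mulVec, Matrix.mul_nonsing_inv _ hdet, Matrix.one_mulVec]
    have hpq2 : p + q = f2 := by
      ext i; simp [hp, hq]; ring
    have hR : (Matrix.fromBlocks P₁ (-P₁) 1 1 : Matrix (Fin m ⊕ Fin m) (Fin m ⊕ Fin m) ℂ) *ᵥ Sum.elim p q = f := by
      rw [Matrix.fromBlocks_mulVec, hf12]
      simp only [Sum.elim_comp_inl, Sum.elim_comp_inr, Matrix.neg_mulVec, Matrix.one_mulVec,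
        ← sub_eq_add_neg, hpq1, hpq2]
    have hz := h p q (by rw [hR, hWf])
    have hfs : star y ⬝ᵥ (W_B *ᵥ g) = star f ⬝ᵥ (Sig *ᵥ g) := by
      have hSS : Sigᴴ * Sig = 1 := by
        rw [hSig, Matrix.fromBlocks_conjTranspose, Matrix.fromBlocks_multiply]
        simp
      rw [hf, Matrix.star_mulVec, ← Matrix.dotProduct_mulVec, Matrix.mulVec_mulVec g, hSS,
        Matrix.one_mulVec, Matrix.star_mulVec, Matrix.conjTranspose_conjTranspose,
        ← Matrix.dotProduct_mulVec]
    have hSg : Sig *ᵥ g = Sum.elim (zb + za) (P₁ *ᵥ zb - P₁ *ᵥ za) := by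
      rw [hg, hSig, Matrix.fromBlocks_mulVec, Matrix.fromBlocks_mulVec]
      simp [Matrix.neg_mulVec, ← sub_eq_add_neg]
    have hsf : star f = Sum.elim (star f1) (star f2) := by ext k; cases k <;> rfl
    rw [hfs, hSg, hsf, sumElim_dotProduct_sumElim, ← hpq1, ← hpq2]
    have sw : ∀ x y : Fin m → ℂ, star (P₁ *ᵥ x) ⬝ᵥ y = star x ⬝ᵥ (P₁ *ᵥ y) := by
      intro x y
      rw [Matrix.star_mulVec, hP₁.eq, ← Matrix.dotProduct_mulVec]
    simp only [star_sub, star_add, sub_dotProduct, add_dotProduct, dotProduct_add,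
      dotProduct_sub, sw]
    linear_combination 2 * hz
  have := key (W_B *ᵥ g)
  exact dotProduct_star_self_eq_zero.1 this

/-- density of the range of the hyperbolic generator, key step for
Proposition `prop:BHsing`: with `H` a.e. Hermitian positive definite and `H`, `H⁻¹`
integrable, `P₀` measurable bounded and pointwise dissipative a.e., `P₁` Hermitian
invertible, and `W_B, W_C` satisfying `Σ = V Σ Vᴴ`, if a function `z` in the weighted
space `X_h*` is orthogonal to `P₀ φ + P₁ φ' − H⁻¹ φ` for every continuously
differentiable `φ` satisfying the homogeneous boundary condition
`W_B·[[P₁, −P₁],[I, I]]·(φ(b), φ(a)) = 0`, then `z = 0` a.e. on `[a, b]`. -/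
theorem dense_range_of_hyperbolic_generator
    (m : ℕ) (a b : ℝ) (hab : a < b)
    (H : ℝ → Matrix (Fin m) (Fin m) ℂ)
    (hHmeas : ∀ i j, Measurable fun ξ => H ξ i j)
    (hHpos : ∀ᵐ ξ ∂(volume.restrict (Set.Icc a b)), (H ξ).PosDef)
    (hHint : ∀ i j, IntegrableOn (fun ξ => ‖H ξ i j‖) (Set.Icc a b))
    (hHinvint : ∀ i j, IntegrableOn (fun ξ => ‖(H ξ)⁻¹ i j‖) (Set.Icc a b))
    (P₀ : ℝ → Matrix (Fin m) (Fin m) ℂ)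
    (hP₀meas : ∀ i j, Measurable fun ξ => P₀ ξ i j)
    (hP₀bdd : ∃ C : ℝ, ∀ ξ ∈ Set.Icc a b, ∀ i j, ‖P₀ ξ i j‖ ≤ C)
    (hP₀diss : ∀ᵐ ξ ∂(volume.restrict (Set.Icc a b)),
      ∀ w : Fin m → ℂ, (star w ⬝ᵥ (P₀ ξ *ᵥ w)).re ≤ 0)
    (P₁ : Matrix (Fin m) (Fin m) ℂ) (hP₁ : P₁.IsHermitian) (hP₁inv : IsUnit P₁)
    (W_B W_C : Matrix (Fin m) (Fin m ⊕ Fin m) ℂ)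
    (V : Matrix (Fin m ⊕ Fin m) (Fin m ⊕ Fin m) ℂ)
    (hV : V = Matrix.fromRows W_B W_C)
    (Sig : Matrix (Fin m ⊕ Fin m) (Fin m ⊕ Fin m) ℂ)
    (hSig : Sig = Matrix.fromBlocks 0 1 1 0)
    (hWBC : Sig = V * Sig * Vᴴ)
    (z : ℝ → (Fin m → ℂ)) (hzmeas : Measurable z)
    (hz : IntegrableOn (fun ξ => (star (z ξ) ⬝ᵥ ((H ξ)⁻¹ *ᵥ z ξ)).re) (Set.Icc a b))
    (hortho : ∀ (φ φ' : ℝ → (Fin m → ℂ)),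
      (∀ ξ ∈ Set.Icc a b, HasDerivAt φ (φ' ξ) ξ) →
      ContinuousOn φ' (Set.Icc a b) →
      W_B *ᵥ (Matrix.fromBlocks P₁ (-P₁) 1 1 *ᵥ Sum.elim (φ b) (φ a)) = 0 →
      (∫ ξ in Set.Icc a b,
        star (P₀ ξ *ᵥ φ ξ + P₁ *ᵥ φ' ξ - (H ξ)⁻¹ *ᵥ φ ξ) ⬝ᵥ z ξ) = 0) :
    ∀ᵐ ξ ∂(volume.restrict (Set.Icc a b)), z ξ = 0 := by
  set h : ℝ → Fin m → ℂ := fun ξ => (P₀ ξ)ᴴ *ᵥ z ξ - (H ξ)⁻¹ *ᵥ z ξ with hh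
  set u : ℝ → Fin m → ℂ := fun ξ => P₁ *ᵥ z ξ with hu
  have hdet : IsUnit P₁.det := (Matrix.isUnit_iff_isUnit_det _).1 hP₁inv
  have hzm : ∀ i, Measurable fun ξ => z ξ i := fun i => (measurable_pi_apply i).comp hzmeas
  have hNm := measurable_inv_entry hHmeas
  have hzi : ∀ i, IntegrableOn (fun ξ => z ξ i) (Set.Icc a b) := by
    intro i
    refine Integrable.mono' ((hHint i i).add hz) (hzm i).aestronglyMeasurable ?_
    filter_upwards [hHpos] with ξ hξ
    exact bound_id hξ (z ξ) i
  have hNi : ∀ i, IntegrableOn (fun ξ => ((H ξ)⁻¹ *ᵥ z ξ) i) (Set.Icc a b) := by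
    intro i
    refine Integrable.mono' ((hHinvint i i).add hz) ?_ ?_
    · refine Measurable.aestronglyMeasurable ?_
      simp only [Matrix.mulVec, dotProduct]
      exact Finset.measurable_sum _ fun k _ => (hNm i k).mul (hzm k)
    · filter_upwards [hHpos] with ξ hξ
      exact bound_inv hξ (z ξ) i
  have hPi : ∀ i, IntegrableOn (fun ξ => ((P₀ ξ)ᴴ *ᵥ z ξ) i) (Set.Icc a b) := by
    intro i
    obtain ⟨C, hC⟩ := hP₀bdd
    simp only [Matrix.mulVec, dotProduct]
    refine integrable_finsetSum _ fun k _ => ?_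
    refine Integrable.bdd_mul (c := C) (hzi k) ?_ ?_
    · refine Measurable.aestronglyMeasurable ?_
      simp only [Matrix.conjTranspose_apply]
      exact continuous_star.measurable.comp (hP₀meas k i)
    · filter_upwards [ae_restrict_mem measurableSet_Icc] with ξ hξ
      simpa using hC ξ hξ k i
  have hhi : ∀ i, IntegrableOn (fun ξ => h ξ i) (Set.Icc a b) := fun i => (hPi i).sub (hNi i)
  have hui : ∀ i, IntegrableOn (fun ξ => u ξ i) (Set.Icc a b) := by
    intro i
    simp only [hu, Matrix.mulVec, dotProduct]
    exact integrable_finsetSum _ fun k _ => (hzi k).const_mul _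
  have toII : ∀ f : ℝ → ℂ, IntegrableOn f (Set.Icc a b) → IntervalIntegrable f volume a b :=
    fun f hf => (intervalIntegrable_iff_integrableOn_Icc_of_le hab.le).2 hf
  have hhI := fun i => toII _ (hhi i)
  have huI := fun i => toII _ (hui i)
  -- the weak form, rewritten
  have weak : ∀ (φ φ' : ℝ → (Fin m → ℂ)),
      (∀ ξ ∈ Set.Icc a b, HasDerivAt φ (φ' ξ) ξ) →
      ContinuousOn φ' (Set.Icc a b) →
      W_B *ᵥ (Matrix.fromBlocks P₁ (-P₁) 1 1 *ᵥ Sum.elim (φ b) (φ a)) = 0 →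
      ∫ x in a..b, ∑ i, (star (φ x i) * h x i + star (φ' x i) * u x i) = 0 := by
    intro φ φ' h1 h2 h3
    rw [intervalIntegral.integral_of_le hab.le, ← integral_Icc_eq_integral_Ioc,
      ← hortho φ φ' h1 h2 h3]
    refine integral_congr_ae ?_
    filter_upwards [hHpos] with ξ hξ
    have e1 : ∑ i, (star (φ ξ i) * h ξ i + star (φ' ξ i) * u ξ i) =
        star (φ ξ) ⬝ᵥ h ξ + star (φ' ξ) ⬝ᵥ u ξ := by
      simp only [dotProduct, Pi.star_apply, Finset.sum_add_distrib]
    rw [e1]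
    simp only [hh, hu, star_sub, star_add, sub_dotProduct, add_dotProduct, dotProduct_sub,
      Matrix.star_mulVec, hP₁.eq, hξ.inv.isHermitian.eq, ← Matrix.dotProduct_mulVec]
    ring
  -- regularity
  have reg : ∀ i, ∃ c : ℂ, ∀ᵐ x ∂(volume.restrict (Set.Icc a b)),
      u x i = c + ∫ v in a..x, h v i := by
    intro i
    refine du_bois_reymond hab (huI i) (hhI i) ?_
    intro ψ hψ h0
    have hd : ∀ x, HasDerivAt (fun y => ∫ v in a..y, ψ v) (ψ x) x := fun x =>
      intervalIntegral.integral_hasDerivAt_right (hψ.intervalIntegrable _ _)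
        hψ.aestronglyMeasurable.stronglyMeasurableAtFilter hψ.continuousAt
    have := weak (fun x => Pi.single i (star (∫ v in a..x, ψ v)))
      (fun x => Pi.single i (star (ψ x))) ?_ ?_ ?_
    · rw [← this]
      congr 1; funext x
      rw [Finset.sum_eq_single i]
      · simp
      · intro k _ hk; simp [hk]
      · simp
    · intro x _
      rw [hasDerivAt_pi]
      intro k
      by_cases hk : k = i
      · subst hk; simpa using (hd x).star
      · simpa [hk] using hasDerivAt_const x (0 : ℂ)
    · refine Continuous.continuousOn ?_
      refine continuous_pi fun k => ?_
      by_cases hk : k = i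
      · subst hk; simpa using hψ.star
      · simpa [hk] using continuous_const
    · simp [h0]
  choose c hc using reg
  set U : ℝ → Fin m → ℂ := fun x i => c i + ∫ v in a..x, h v i with hU
  have huU : ∀ᵐ x ∂(volume.restrict (Set.Icc a b)), u x = U x := by
    filter_upwards [ae_all_iff.2 hc] with x hx
    funext i; exact hx i
  have hUa : U a = c := by funext i; simp [hU]
  have hUc : ∀ i, ContinuousOn (fun x => U x i) (Set.uIcc a b) := fun i =>
    ((ac_const (c i) a b).add (ac_primitive (hhI i))).continuousOn
  have hPU : ∀ x, P₁ *ᵥ (P₁⁻¹ *ᵥ U x) = U x := by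
    intro x
    rw [Matrix.mulVec_mulVec, Matrix.mul_nonsing_inv _ hdet, Matrix.one_mulVec]
  -- boundary conditions
  have bd := boundary P₁ hP₁ hP₁inv W_B W_C V hV Sig hSig hWBC (P₁⁻¹ *ᵥ U b) (P₁⁻¹ *ᵥ U a) (by
    intro p q hpq
    rw [hPU, hPU]
    have hba : ((b - a : ℝ) : ℂ) ≠ 0 := by
      exact_mod_cast (sub_pos.2 hab).ne'
    set r : Fin m → ℂ := ((b - a : ℝ) : ℂ)⁻¹ • (p - q) with hr
    have hφb : q + ((b - a : ℝ) : ℂ) • r = p := by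
      rw [hr, smul_smul, mul_inv_cancel₀ hba, one_smul]; abel
    have w1 := weak (fun x => q + ((x - a : ℝ) : ℂ) • r) (fun _ => r) ?_ continuousOn_const ?_
    · have w2 : ∀ i, ∫ x in a..b, (star (r i) * U x i +
          (star (q i) + ∫ v in a..x, star (r i)) * h x i) =
            star (p i) * U b i - star (q i) * U a i := by
        intro i
        have := by_parts (a := a) (b := b) (f := fun _ => star (r i)) (g := fun x => h x i)
          intervalIntegrable_const (hhI i) (star (q i)) (c i)
        rw [hUa]
        refine this.trans ?_
        rw [← hφb]
        simp [hU]
      have : ∫ x in a..b, ∑ i, (star ((q + ((x - a : ℝ) : ℂ) • r) i) * h x i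
          + star (r i) * u x i) = ∫ x in a..b, ∑ i, (star (r i) * U x i +
          (star (q i) + ∫ v in a..x, star (r i)) * h x i) := by
        rw [intervalIntegral.integral_of_le hab.le, intervalIntegral.integral_of_le hab.le,
          ← integral_Icc_eq_integral_Ioc, ← integral_Icc_eq_integral_Ioc]
        refine integral_congr_ae ?_
        filter_upwards [huU] with x hx
        refine Finset.sum_congr rfl fun i _ => ?_
        rw [hx]
        simp
        ring
      rw [this, intervalIntegral.integral_finsetSum] at w1
      · simp only [w2, Finset.sum_sub_distrib] at w1
        exact w1
      · intro i _
        refine ((hUc i).intervalIntegrable.const_mul _).add ((hhI i).continuousOn_mul ?_)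
        simp only [intervalIntegral.integral_const]
        fun_prop
    · intro x _
      have h1 : HasDerivAt (fun x : ℝ => ((x - a : ℝ) : ℂ)) 1 x := by
        simpa using ((hasDerivAt_id x).sub_const a).ofReal_comp
      simpa using (h1.smul_const r).const_add q
    · simp only [hφb]
      simpa using hpq)
  rw [hPU, hPU] at bd
  -- energy identity
  have hstar : ∀ i x, star (U x i) = star (c i) + ∫ v in a..x, star (h v i) := by
    intro i x
    simp only [hU, star_add]
    congr 1
    rw [intervalIntegral.intervalIntegral_eq_integral_uIoc,
      intervalIntegral.intervalIntegral_eq_integral_uIoc]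
    have := integral_conj (μ := volume.restrict (Set.uIoc a x)) (f := fun v => h v i)
    simp only [starRingEnd_apply] at this
    rw [this]
    split_ifs <;> simp
  have hshI : ∀ i, IntervalIntegrable (fun x => star (h x i)) volume a b := by
    intro i
    exact toII _ ((Complex.conjCLE : ℂ →L[ℝ] ℂ).integrable_comp (hhi i))
  have en : ∀ i j, ∫ x in a..b, (star (h x i) * U x j + star (U x i) * h x j) =
      star (U b i) * U b j - star (U a i) * U a j := by
    intro i j
    have := by_parts (hshI i) (hhI j) (star (c i)) (c j)
    simp only [hstar, hUa]
    exact this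
  have enI : ∀ i j, IntervalIntegrable
      (fun x => star (h x i) * U x j + star (U x i) * h x j) volume a b := by
    intro i j
    exact ((hshI i).mul_continuousOn (hUc j)).add ((hhI j).continuousOn_mul (hUc i).star)
  have quad : ∀ x y : Fin m → ℂ, star x ⬝ᵥ (P₁⁻¹ *ᵥ y) =
      ∑ i, ∑ j, P₁⁻¹ i j * (star (x i) * y j) := by
    intro x y
    simp only [Matrix.mulVec, dotProduct, Finset.mul_sum, Pi.star_apply]
    refine Finset.sum_congr rfl fun i _ => Finset.sum_congr rfl fun j _ => by ring
  have hPinv : (P₁⁻¹).IsHermitian := hP₁.inv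
  have swi : ∀ x y : Fin m → ℂ, star (P₁⁻¹ *ᵥ x) ⬝ᵥ y = star x ⬝ᵥ (P₁⁻¹ *ᵥ y) := by
    intro x y
    rw [Matrix.star_mulVec, hPinv.eq, ← Matrix.dotProduct_mulVec]
  have tot : ∫ x in a..b, (star (h x) ⬝ᵥ (P₁⁻¹ *ᵥ U x) + star (U x) ⬝ᵥ (P₁⁻¹ *ᵥ h x)) = 0 := by
    have e : ∀ x, star (h x) ⬝ᵥ (P₁⁻¹ *ᵥ U x) + star (U x) ⬝ᵥ (P₁⁻¹ *ᵥ h x) =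
        ∑ i, ∑ j, P₁⁻¹ i j * (star (h x i) * U x j + star (U x i) * h x j) := by
      intro x
      simp only [quad, ← Finset.sum_add_distrib, mul_add]
    simp only [e]
    rw [intervalIntegral.integral_finsetSum]
    · rw [← bd, swi, swi, quad, quad, ← Finset.sum_sub_distrib]
      refine Finset.sum_congr rfl fun i _ => ?_
      rw [intervalIntegral.integral_finsetSum]
      · rw [← Finset.sum_sub_distrib]
        refine Finset.sum_congr rfl fun j _ => ?_
        rw [intervalIntegral.integral_const_mul, en]
        ring
      · intro j _; exact (enI i j).const_mul _
    · intro i _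
      refine toII _ (integrable_finsetSum _ fun j _ => ?_)
      exact ((intervalIntegrable_iff_integrableOn_Icc_of_le hab.le).1 (enI i j)).const_mul _
  have totI : IntegrableOn (fun x => star (h x) ⬝ᵥ (P₁⁻¹ *ᵥ U x) +
      star (U x) ⬝ᵥ (P₁⁻¹ *ᵥ h x)) (Set.Icc a b) := by
    have e : ∀ x, star (h x) ⬝ᵥ (P₁⁻¹ *ᵥ U x) + star (U x) ⬝ᵥ (P₁⁻¹ *ᵥ h x) =
        ∑ i, ∑ j, P₁⁻¹ i j * (star (h x i) * U x j + star (U x i) * h x j) := by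
      intro x
      simp only [quad, ← Finset.sum_add_distrib, mul_add]
    simp only [e]
    refine integrable_finsetSum _ fun i _ => integrable_finsetSum _ fun j _ => ?_
    exact ((intervalIntegrable_iff_integrableOn_Icc_of_le hab.le).1 (enI i j)).const_mul _
  rw [intervalIntegral.integral_of_le hab.le, ← integral_Icc_eq_integral_Ioc] at tot
  set T : ℝ → ℂ := fun x => star (h x) ⬝ᵥ (P₁⁻¹ *ᵥ U x) + star (U x) ⬝ᵥ (P₁⁻¹ *ᵥ h x) with hT
  have totre : ∫ x in Set.Icc a b, (T x).re = 0 := by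
    have : ∫ x in Set.Icc a b, (T x).re = (∫ x in Set.Icc a b, T x).re :=
      Complex.reCLM.integral_comp_comm totI
    rw [this, tot]; rfl
  set Q : ℝ → ℝ := fun ξ => (star (z ξ) ⬝ᵥ ((H ξ)⁻¹ *ᵥ z ξ)).re with hQ
  have hTle : ∀ᵐ x ∂(volume.restrict (Set.Icc a b)), (T x).re ≤ - Q x := by
    filter_upwards [huU, hP₀diss, hHpos] with x hx hd hpd
    have hQ0 : 0 ≤ Q x :=
      (Complex.le_def.1 (hpd.inv.posSemidef.dotProduct_mulVec_nonneg (z x))).1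
    have hzU : P₁⁻¹ *ᵥ U x = z x := by
      rw [← hx, hu]
      simp only [Matrix.mulVec_mulVec, Matrix.nonsing_inv_mul _ hdet, Matrix.one_mulVec]
    have e1 : star (U x) ⬝ᵥ (P₁⁻¹ *ᵥ h x) = star (z x) ⬝ᵥ h x := by
      rw [← swi, hzU]
    have e2 : star (h x) ⬝ᵥ z x = star (star (z x) ⬝ᵥ h x) := by
      rw [← Matrix.star_dotProduct_star, star_star, dotProduct_comm]
    have e3 : star (z x) ⬝ᵥ ((P₀ x)ᴴ *ᵥ z x) = star (star (z x) ⬝ᵥ (P₀ x *ᵥ z x)) := by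
      rw [← Matrix.star_dotProduct_star, star_star, Matrix.star_mulVec, dotProduct_comm,
        ← Matrix.dotProduct_mulVec, dotProduct_comm]
    have e4 : (star (z x) ⬝ᵥ h x).re = (star (z x) ⬝ᵥ (P₀ x *ᵥ z x)).re - Q x := by
      simp only [hh, dotProduct_sub, e3, Complex.sub_re, hQ]
      simp
    simp only [hT, hzU, e1, e2, Complex.add_re]
    have e5 : (star (star (z x) ⬝ᵥ h x)).re = (star (z x) ⬝ᵥ h x).re := by simp
    rw [e5, e4]
    have := hd (z x)
    linarith
  have hQnn : 0 ≤ᵐ[volume.restrict (Set.Icc a b)] Q := by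
    filter_upwards [hHpos] with x hpd
    exact (Complex.le_def.1 (hpd.inv.posSemidef.dotProduct_mulVec_nonneg (z x))).1
  have hQint : ∫ x in Set.Icc a b, Q x ≤ 0 := by
    have h1 : ∫ x in Set.Icc a b, (T x).re ≤ ∫ x in Set.Icc a b, - Q x :=
      integral_mono_ae totI.re hz.neg hTle
    rw [totre, integral_neg] at h1
    linarith
  have hQ0 : Q =ᵐ[volume.restrict (Set.Icc a b)] 0 :=
    (integral_eq_zero_iff_of_nonneg_ae hQnn hz).1
      (le_antisymm hQint (integral_nonneg_of_ae hQnn))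
  filter_upwards [hQ0, hHpos] with x hx hpd
  by_contra hne
  have := (Complex.lt_def.1 (hpd.inv.dotProduct_mulVec_pos hne)).1
  simp only [hQ, Pi.zero_apply] at hx
  simp only [Complex.zero_re] at this
  linarith
end
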